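/- arXiv:2210.03891 — 2 statements merged into one kernel-verified Lean document; each statement's English description precedes it below -/
import Mathlib

section
/- Let R be a commutative Noetherian ring and let M be a finitely generated R-submodule of the total ring of fractions Q(R) containing the image of a non-zero-divisor of R. Let P₁ →f→ P₀ → M → 0 be an exact sequence with P₁, P₀ finitely generated projective R-modules, and let Tr M = coker(f* : Hom_R(P₀,R) → Hom_R(P₁,R)) be the corresponding Auslander transpose. Then the trace ideal Tr_R(M) equals ann_R Tor_1^R(M, Tr M). -/
open CategoryTheory Opposite

universe u

/-- The trace ideal of an `R`-module `M`: the ideal of `R` generated by the images of all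
`R`-linear maps `M → R`. -/
noncomputable def traceIdeal (R : Type u) [CommRing R] (M : Type u)
    [AddCommGroup M] [Module R M] : Ideal R :=
  ⨆ f : M →ₗ[R] R, LinearMap.range f

section

section cat
open CategoryTheory.Limits
variable {C : Type*} [Category C] [Abelian C] [EnoughProjectives C]

lemma proj_d_comp {X₁ X₀ : C} (f : X₁ ⟶ X₀) : Projective.d f ≫ f = 0 := by
  exact (Category.assoc _ _ _).trans ((congrArg _ (kernel.condition f)).trans comp_zero)

noncomputable def myCx {X₁ X₀ : C} (d : X₁ ⟶ X₀) : ChainComplex C ℕ :=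
  ChainComplex.mk' X₀ X₁ d (fun f => ⟨_, Projective.d f, proj_d_comp f⟩)

lemma myCx_exact {X₁ X₀ : C} (d : X₁ ⟶ X₀) (n : ℕ) : (myCx d).ExactAt (n+1) := by
  rw [HomologicalComplex.exactAt_iff' _ (n + 1 + 1) (n + 1) n (by simp) (by simp)]
  let e : (myCx d).sc' (n+1+1) (n+1) n ≅ ShortComplex.mk (Projective.d ((myCx d).d (n+1) n)) ((myCx d).d (n+1) n) (proj_d_comp _) :=
    ShortComplex.isoMk (ChainComplex.mk'XIso X₀ X₁ d (fun f => ⟨_, Projective.d f, proj_d_comp f⟩) n) (Iso.refl _) (Iso.refl _)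
      ((ChainComplex.mk'_d X₀ X₁ d (fun f => ⟨_, Projective.d f, proj_d_comp f⟩) n).symm.trans (Category.comp_id _).symm)
      ((Category.id_comp _).trans (Category.comp_id _).symm)
  exact (ShortComplex.exact_iff_of_iso e).2 (exact_d_f _)

lemma myCx_proj {X₁ X₀ : C} [Projective X₁] [Projective X₀] (d : X₁ ⟶ X₀) (n : ℕ) :
    Projective ((myCx d).X n) := by
  obtain (_ | _ | n) := n
  · exact (inferInstance : Projective X₀)
  · exact (inferInstance : Projective X₁)
  · exact Projective.of_iso (ChainComplex.mk'XIso X₀ X₁ d (fun f => ⟨_, Projective.d f, proj_d_comp f⟩) n).symm (Projective.projective_over _)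

lemma myCx_d {X₁ X₀ : C} (d : X₁ ⟶ X₀) : (myCx d).d 1 0 = d := by simp [myCx]

lemma exists_res {X₁ X₀ Z : C} [Projective X₁] [Projective X₀] (d : X₁ ⟶ X₀) (p : X₀ ⟶ Z)
    (hz : d ≫ p = 0) (hex : (ShortComplex.mk d p hz).Exact) [Epi p] :
    ∃ P : ProjectiveResolution Z, P.complex = myCx d := by
  refine ⟨{ complex := myCx d, projective := myCx_proj d, 
            π := (ChainComplex.toSingle₀Equiv _ _).symm ⟨p, ?_⟩, quasiIso := ⟨fun n => ?_⟩ }, rfl⟩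
  · rw [myCx_d]; exact hz
  · cases n
    · rw [ChainComplex.quasiIsoAt₀_iff, ShortComplex.quasiIso_iff_of_zeros']
      · refine (ShortComplex.exact_and_epi_g_iff_of_iso ?_).2
          ⟨hex, by dsimp; infer_instance⟩
        refine ShortComplex.isoMk (Iso.refl _) (Iso.refl _) (Iso.refl _)
          ?_ ?_
        · exact (Category.id_comp _).trans ((myCx_d d).symm.trans (Category.comp_id _).symm)
        · refine (Category.id_comp _).trans (Eq.trans ?_ (Category.comp_id _).symm)
          exact (ChainComplex.toSingle₀Equiv_symm_apply_f_zero (C := myCx d) p (by rw [myCx_d]; exact hz)).symm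
      all_goals rfl
    · rw [quasiIsoAt_iff_exactAt']
      · apply myCx_exact
      · apply ChainComplex.exactAt_succ_single_obj
end cat

lemma mem_ann_homology {R : Type u} [CommRing R] (S : ShortComplex (ModuleCat.{u} R)) (r : R) :
    r ∈ Module.annihilator R S.homology ↔ ∀ x : S.X₂, S.g x = 0 → ∃ y, S.f y = r • x := by
  rw [(S.moduleCatHomologyIso.toLinearEquiv).annihilator_eq]
  change r ∈ Module.annihilator R (LinearMap.ker S.g.hom ⧸ LinearMap.range S.moduleCatToCycles) ↔ _
  rw [Submodule.annihilator_quotient]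
  simp only [Submodule.mem_colon, Subtype.forall, LinearMap.mem_ker, LinearMap.mem_range, Subtype.ext_iff]
  constructor
  · intro h x hx
    exact h x hx trivial
  · intro h x hx _
    exact h x hx
end

lemma frac_comm {R : Type u} [CommRing R] (M : Submodule R (Localization (nonZeroDivisors R)))
    (φ : M →ₗ[R] R) (x y : M) : φ x • y = φ y • x := by
  obtain ⟨⟨a, b⟩, s, h1, h2⟩ : ∃ p : R × R, ∃ s ∈ nonZeroDivisors R,
      s • (x : Localization (nonZeroDivisors R)) = algebraMap R _ p.1 ∧
      s • (y : Localization (nonZeroDivisors R)) = algebraMap R _ p.2 := by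
    obtain ⟨⟨a, s⟩, h⟩ := IsLocalization.surj (nonZeroDivisors R) (x : Localization (nonZeroDivisors R))
    obtain ⟨⟨b, t⟩, h'⟩ := IsLocalization.surj (nonZeroDivisors R) (y : Localization (nonZeroDivisors R))
    refine ⟨(a * t, b * s), s * t, (s * t).2, ?_, ?_⟩
    · simp only [Algebra.smul_def, map_mul] at h ⊢
      rw [← h]; ring
    · simp only [Algebra.smul_def, map_mul] at h' ⊢
      rw [← h']; ring
  have hu := IsLocalization.map_units (Localization (nonZeroDivisors R)) (⟨s, h1⟩ : nonZeroDivisors R)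
  obtain ⟨h2, h3⟩ := h2
  simp only [Algebra.smul_def] at h2 h3 hu
  have e1 : a • y = b • x := by
    apply Subtype.ext
    simp only [Submodule.coe_smul, Algebra.smul_def]
    rw [← h2, ← h3]; ring
  have e2 : a * φ y = b * φ x := by
    have := congrArg φ e1
    simpa using this
  apply Subtype.ext
  simp only [Submodule.coe_smul, Algebra.smul_def]
  apply hu.mul_left_cancel
  have e3 := congrArg (algebraMap R (Localization (nonZeroDivisors R))) e2
  simp only [map_mul] at e3
  linear_combination (algebraMap R (Localization (nonZeroDivisors R)) (φ x)) * h3 - (algebraMap R (Localization (nonZeroDivisors R)) (φ y)) * h2 - e3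

lemma mem_trace_iff {R : Type u} [CommRing R] (M : Submodule R (Localization (nonZeroDivisors R)))
    (hreg : ∃ r ∈ nonZeroDivisors R,
      algebraMap R (Localization (nonZeroDivisors R)) r ∈ M) (r : R) :
    r ∈ traceIdeal R M ↔ ∀ e : M →ₗ[R] M, r • e ∈ LinearMap.range (dualTensorHom R M M) := by
  constructor
  · intro h e
    induction h using Submodule.iSup_induction' with
    | mem φ x hx =>
      obtain ⟨m, rfl⟩ := hx
      refine ⟨(φ ∘ₗ e) ⊗ₜ m, ?_⟩
      ext1 y
      simp only [dualTensorHom_apply, LinearMap.comp_apply, LinearMap.smul_apply]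
      exact frac_comm M φ _ _
    | zero => simp
    | add x y _ _ hx hy => rw [add_smul]; exact add_mem hx hy
  · intro h
    obtain ⟨t, ht⟩ := h LinearMap.id
    have key : ∀ t, ∃ c ∈ traceIdeal R M, ∀ x : M, dualTensorHom R M M t x = c • x := by
      intro t
      induction t using TensorProduct.induction_on with
      | zero => exact ⟨0, zero_mem _, by simp⟩
      | tmul φ m =>
        refine ⟨φ m, Submodule.mem_iSup_of_mem φ ⟨m, rfl⟩, fun x => ?_⟩
        rw [dualTensorHom_apply]; exact frac_comm M φ _ _
      | add a b ha hb =>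
        obtain ⟨c, hc, h1⟩ := ha
        obtain ⟨d, hd, h2⟩ := hb
        exact ⟨c + d, add_mem hc hd, fun x => by rw [map_add, LinearMap.add_apply, h1, h2, add_smul]⟩
    obtain ⟨c, hc, h1⟩ := key t
    obtain ⟨s, hs, hsM⟩ := hreg
    have := h1 ⟨_, hsM⟩
    rw [ht] at this
    have h2 := congrArg Subtype.val this
    rw [LinearMap.smul_apply, LinearMap.id_apply] at h2
    simp only [Submodule.coe_smul] at h2
    rw [Algebra.smul_def, Algebra.smul_def, ← map_mul, ← map_mul] at h2
    have h3 := IsLocalization.injective (Localization (nonZeroDivisors R)) le_rfl h2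
    rwa [(mul_cancel_right_mem_nonZeroDivisors hs).1 h3]

open TensorProduct in
lemma final_lin {R : Type u} [CommRing R] {M P₁ P₀ P₂ : Type u} [AddCommGroup P₁] [Module R P₁] [AddCommGroup P₀] [Module R P₀]
    [AddCommGroup P₂] [Module R P₂] [AddCommGroup M] [Module R M] 
    [Module.Finite R P₁] [Module.Projective R P₁]
    [Module.Finite R P₀] [Module.Projective R P₀]
    (f : P₁ →ₗ[R] P₀) (g : P₀ →ₗ[R] M)
    (hexact : Function.Exact f g) (hg : Function.Surjective g) 
    (k : P₂ →ₗ[R] Module.Dual R P₀) (hk : Function.Exact k f.dualMap) (r : R) :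
    (∀ e : M →ₗ[R] M, r • e ∈ LinearMap.range (dualTensorHom R M M)) ↔
     ∀ x : M ⊗[R] Module.Dual R P₀, LinearMap.lTensor M f.dualMap x = 0 →
       ∃ y, LinearMap.lTensor M k y = r • x := by
  -- D = Hom iso
  let D (P : Type u) [AddCommGroup P] [Module R P] : M ⊗[R] Module.Dual R P →ₗ[R] (P →ₗ[R] M) :=
    dualTensorHom R P M ∘ₗ (TensorProduct.comm R M (Module.Dual R P)).toLinearMap
  have hD : ∀ (P : Type u) [AddCommGroup P] [Module R P] [Module.Finite R P] [Module.Projective R P],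
      Function.Bijective (D P) := fun P _ _ _ _ => by
    simp only [D, LinearMap.coe_comp, LinearEquiv.coe_coe]
    exact (dualTensorHomEquiv R P M).bijective.comp (LinearEquiv.bijective _)
  have nat : ∀ {P Q : Type u} [AddCommGroup P] [Module R P] [AddCommGroup Q] [Module R Q]
      (q : P →ₗ[R] Q) (x), D P (LinearMap.lTensor M q.dualMap x) = D Q x ∘ₗ q := by
    intro P Q _ _ _ _ q x
    induction x using TensorProduct.induction_on with
    | zero => simp
    | tmul m φ => ext; simp [D]
    | add a b ha hb => simp only [map_add, ha, hb, LinearMap.add_comp]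
  have hgd : LinearMap.range g.dualMap = LinearMap.range k := by
    rw [← (LinearMap.exact_iff.1 hk)]
    ext φ
    constructor
    · rintro ⟨ψ, rfl⟩
      ext z
      simp [hexact.apply_apply_eq_zero]
    · intro hφ
      have h0 : ∀ z, φ (f z) = 0 := fun z => LinearMap.congr_fun (LinearMap.mem_ker.1 hφ) z
      have hle : LinearMap.ker g ≤ LinearMap.ker φ := by
        intro z hz
        obtain ⟨w, rfl⟩ := (hexact z).1 hz
        exact h0 w
      refine ⟨(Submodule.liftQ _ φ hle) ∘ₗ (g.quotKerEquivOfSurjective hg).symm.toLinearMap, ?_⟩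
      ext z
      have : (g.quotKerEquivOfSurjective hg).symm (g z) = Submodule.Quotient.mk z := by
        rw [LinearEquiv.symm_apply_eq]; rfl
      simp [this]
  have hrange : LinearMap.range (LinearMap.lTensor M g.dualMap) = LinearMap.range (LinearMap.lTensor M k) := by
    have a1 := LinearMap.lTensor_range M (g := g.dualMap)
    have a2 := LinearMap.lTensor_range M (g := k)
    rw [hgd] at a1
    exact a1.trans a2.symm
  have hgc : ∀ a b : M →ₗ[R] M, a ∘ₗ g = b ∘ₗ g → a = b := fun a b h =>
    LinearMap.ext fun z => by obtain ⟨w, rfl⟩ := hg z; exact LinearMap.congr_fun h w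
  have hDr : ∀ e, e ∈ LinearMap.range (dualTensorHom R M M) ↔ ∃ t, D M t = e := by
    intro e
    constructor
    · rintro ⟨t, rfl⟩; exact ⟨(TensorProduct.comm R M _).symm t, by simp [D]⟩
    · rintro ⟨t, rfl⟩; exact ⟨_, rfl⟩
  constructor
  · intro h x hx
    have h1 : D P₀ x ∘ₗ f = 0 := by rw [← nat, hx, map_zero]
    have hle : LinearMap.ker g ≤ LinearMap.ker (D P₀ x) := by
      intro z hz
      obtain ⟨w, rfl⟩ := (hexact z).1 hz
      exact LinearMap.congr_fun h1 w
    let e : M →ₗ[R] M := (Submodule.liftQ _ (D P₀ x) hle) ∘ₗ (g.quotKerEquivOfSurjective hg).symm.toLinearMap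
    have he : e ∘ₗ g = D P₀ x := by
      ext1 z
      have : (g.quotKerEquivOfSurjective hg).symm (g z) = Submodule.Quotient.mk z := by
        rw [LinearEquiv.symm_apply_eq]; rfl
      simp [e, this]
    obtain ⟨t, ht⟩ := (hDr _).1 (h e)
    have : r • x ∈ LinearMap.range (LinearMap.lTensor M g.dualMap) := by
      refine ⟨t, (hD P₀).1 ?_⟩
      rw [nat, ht, map_smul, ← he]; rfl
    rw [hrange] at this
    exact this
  · intro h e
    obtain ⟨x, hx⟩ := (hD P₀).2 (e ∘ₗ g)
    have h1 : LinearMap.lTensor M f.dualMap x = 0 := by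
      apply (hD P₁).1
      rw [nat, hx, map_zero]
      ext1 z
      simp [hexact.apply_apply_eq_zero]
    have h2 : r • x ∈ LinearMap.range (LinearMap.lTensor M k) := h x h1
    rw [← hrange] at h2
    obtain ⟨t, ht⟩ := h2
    rw [hDr]
    refine ⟨t, hgc _ _ ?_⟩
    rw [← nat, ht, map_smul, hx]; rfl
theorem trace_eq_ann_tor_one_transpose (R : Type u) [CommRing R] [IsNoetherianRing R]
    (M : Submodule R (Localization (nonZeroDivisors R)))
    (hfg : M.FG)
    (hreg : ∃ r ∈ nonZeroDivisors R,
      algebraMap R (Localization (nonZeroDivisors R)) r ∈ M)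
    (P₁ P₀ : Type u) [AddCommGroup P₁] [Module R P₁] [AddCommGroup P₀] [Module R P₀]
    [Module.Finite R P₁] [Module.Projective R P₁]
    [Module.Finite R P₀] [Module.Projective R P₀]
    (f : P₁ →ₗ[R] P₀) (g : P₀ →ₗ[R] ↥M)
    (hexact : Function.Exact f g) (hg : Function.Surjective g) :
    traceIdeal R ↥M =
      Module.annihilator R
        (((Tor (ModuleCat.{u} R) 1).obj (ModuleCat.of R ↥M)).obj
          (ModuleCat.of R ((Module.Dual R P₁) ⧸ LinearMap.range (LinearMap.dualMap f)))) := by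
  let N := (Module.Dual R P₁) ⧸ LinearMap.range (LinearMap.dualMap f)
  let d : ModuleCat.of R (Module.Dual R P₀) ⟶ ModuleCat.of R (Module.Dual R P₁) :=
    ModuleCat.ofHom f.dualMap
  let p : ModuleCat.of R (Module.Dual R P₁) ⟶ ModuleCat.of R N :=
    ModuleCat.ofHom (Submodule.mkQ _)
  have hz : d ≫ p = 0 := by
    ext x
    exact (Submodule.Quotient.mk_eq_zero _).2 ⟨x, rfl⟩
  have hp : Epi p := (ModuleCat.epi_iff_surjective _).2 (Submodule.mkQ_surjective _)
  have hex : (ShortComplex.mk d p hz).Exact := by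
    rw [ShortComplex.moduleCat_exact_iff]
    intro x hx
    exact (Submodule.Quotient.mk_eq_zero _).1 hx
  have pr₀ : Projective (ModuleCat.of R (Module.Dual R P₀)) :=
    (IsProjective.iff_projective _).1 inferInstance
  have pr₁ : Projective (ModuleCat.of R (Module.Dual R P₁)) :=
    (IsProjective.iff_projective _).1 inferInstance
  obtain ⟨P, hP⟩ := exists_res d p hz hex
  let F := (MonoidalCategory.tensoringLeft (ModuleCat.{u} R)).obj (ModuleCat.of R M)
  let K := (F.mapHomologicalComplex (ComplexShape.down ℕ)).obj (myCx d)
  have i1 : Nonempty ((((Tor (ModuleCat.{u} R) 1).obj (ModuleCat.of R ↥M)).obj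
      (ModuleCat.of R N)) ≅ (K.sc' 2 1 0).homology) := by
    have i0 := P.isoLeftDerivedObj F 1
    rw [hP] at i0
    exact ⟨i0 ≪≫ ShortComplex.homologyMapIso (K.isoSc' 2 1 0 (by simp) (by simp))⟩
  obtain ⟨i1⟩ := i1
  have hk : Function.Exact ((myCx d).d 2 1).hom f.dualMap := by
    have h := (HomologicalComplex.exactAt_iff' _ 2 1 0 (by simp) (by simp)).1 (myCx_exact d 0)
    have h' := (ShortComplex.ShortExact.moduleCat_exact_iff_function_exact _).1 h
    have e : (myCx d).d 1 0 = d := myCx_d d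
    have h2 : Function.Exact ((myCx d).d 2 1).hom ((myCx d).d 1 0).hom := h'
    rw [e] at h2
    exact h2
  ext r
  rw [mem_trace_iff M hreg, i1.toLinearEquiv.annihilator_eq, mem_ann_homology,
    final_lin f g hexact hg _ hk]
  have hg' : (K.sc' 2 1 0).g = F.map d := congrArg F.map (myCx_d d)
  have key : ∀ x : (K.sc' 2 1 0).X₂, (K.sc' 2 1 0).g x = F.map d x := fun x => by
    rw [hg']; rfl
  constructor
  · intro h x hx
    rw [key] at hx
    exact h x hx
  · intro h x hx
    exact h x ((key x).trans hx)
end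

section
/- Let (R, 𝔪) be a one-dimensional Noetherian local ring whose 𝔪-adic completion is reduced. Let 𝒳 be any class of R-modules containing every second syzygy of a finitely generated torsion-free R-module (i.e., every module K fitting in an exact sequence 0 → K → P₁ → P₀ → N → 0 with P₀, P₁ finitely generated projective and N finitely generated torsion-free), and let 𝒴 be any class of R-modules containing all finitely generated torsion-free R-modules. Then ⋂_{i≥1, M fin. gen. torsion-free, N ∈ 𝒳} ann_R Ext^i_R(M,N) = ⋂_{i≥2, M fin. gen. torsion-free, N ∈ 𝒳} ann_R Ext^i_R(M,N) = ⋂_{i≥1, M fin. gen. torsion-free, N ∈ 𝒴} ann_R Tor_i^R(M,N) = 𝒞(R). -/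
open CategoryTheory Opposite

universe u

/-- The conductor of a commutative ring `S` in the integral closure `S̄` of `S` inside its total
ring of fractions `Q(S)`: the ideal `(S : S̄) = {q ∈ Q(S) : q·S̄ ⊆ S}` of `S`. -/
noncomputable def conductorIdeal (S : Type u) [CommRing S] : Ideal S :=
  Submodule.comap (Algebra.linearMap S (Localization (nonZeroDivisors S)))
    ((1 : Submodule S (Localization (nonZeroDivisors S))) /
      (Subalgebra.toSubmodule (integralClosure S (Localization (nonZeroDivisors S)))))


lemma aux_homology {R : Type u} [CommRing R] (S : ShortComplex (ModuleCat.{u} R)) (r : R) :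
    r ∈ Module.annihilator R S.homology ↔
      ∀ x : S.X₂, S.g.hom x = 0 → ∃ y : S.X₁, S.f.hom y = r • x := by
  have e : S.homology ≃ₗ[R] (LinearMap.ker S.g.hom ⧸ LinearMap.range S.moduleCatToCycles) :=
    S.moduleCatHomologyIso.toLinearEquiv
  rw [e.annihilator_eq]
  rw [Module.mem_annihilator]
  constructor
  · intro h x hx
    have := h (Submodule.Quotient.mk (⟨x, hx⟩ : LinearMap.ker S.g.hom))
    rw [← Submodule.Quotient.mk_smul, Submodule.Quotient.mk_eq_zero] at this
    obtain ⟨y, hy⟩ := this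
    exact ⟨y, congrArg Subtype.val hy⟩
  · intro h z
    obtain ⟨⟨x, hx⟩, rfl⟩ := Submodule.Quotient.mk_surjective _ z
    obtain ⟨y, hy⟩ := h x hx
    rw [← Submodule.Quotient.mk_smul, Submodule.Quotient.mk_eq_zero]
    exact ⟨y, Subtype.ext hy⟩

lemma aux_homology' {R : Type u} [CommRing R] {ι : Type*} {c : ComplexShape ι}
    (S : HomologicalComplex (ModuleCat.{u} R) c)
    (i j k : ι) (hi : c.prev j = i) (hk : c.next j = k) (r : R) :
    r ∈ Module.annihilator R (S.homology j) ↔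
      ∀ x : S.X j, (S.d j k).hom x = 0 → ∃ y : S.X i, (S.d i j).hom y = r • x := by
  have e : S.homology j ≃ₗ[R] (S.sc' i j k).homology := 
    (ShortComplex.homologyMapIso (S.isoSc' i j k hi hk)).toLinearEquiv
  rw [e.annihilator_eq]
  exact aux_homology _ _

lemma aux_ext {R : Type u} [CommRing R] {M : ModuleCat.{u} R} (P : ProjectiveResolution M)
    (N : ModuleCat.{u} R) (n : ℕ) (r : R) :
    r ∈ Module.annihilator R (((Ext R (ModuleCat.{u} R) (n+1)).obj (op M)).obj N) ↔
      ∀ φ : P.complex.X (n+1) ⟶ N, P.complex.d (n+2) (n+1) ≫ φ = 0 →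
        ∃ ψ : P.complex.X n ⟶ N, P.complex.d (n+1) n ≫ ψ = r • φ := by
  rw [(P.isoExt (R := R) (n+1) N).toLinearEquiv.annihilator_eq]
  rw [aux_homology' _ n (n+1) (n+2) (by simp) (by simp)]
  rfl

open TensorProduct in
lemma aux_tor {R : Type u} [CommRing R] (M : ModuleCat.{u} R) {N : ModuleCat.{u} R}
    (P : ProjectiveResolution N)
    (n : ℕ) (r : R) :
    r ∈ Module.annihilator R (((Tor (ModuleCat.{u} R) (n+1)).obj M).obj N) ↔
      ∀ x : M ⊗[R] P.complex.X (n+1), (P.complex.d (n+1) n).hom.lTensor M x = 0 →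
        ∃ y : M ⊗[R] P.complex.X (n+2), (P.complex.d (n+2) (n+1)).hom.lTensor M y = r • x := by
  change r ∈ Module.annihilator R ((((MonoidalCategory.tensoringLeft
    (ModuleCat.{u} R)).obj M).leftDerived (n+1)).obj N) ↔ _
  rw [(P.isoLeftDerivedObj _ (n+1)).toLinearEquiv.annihilator_eq]
  exact aux_homology' ((((MonoidalCategory.tensoringLeft (ModuleCat.{u} R)).obj
    M).mapHomologicalComplex _).obj P.complex) (n+2) (n+1) n (by simp) (by simp) r

lemma aux_exact_succ {R : Type u} [CommRing R] {N : ModuleCat.{u} R}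
    (P : ProjectiveResolution N) (n : ℕ) :
    Function.Exact (P.complex.d (n+2) (n+1)).hom (P.complex.d (n+1) n).hom :=
  (ShortComplex.ShortExact.moduleCat_exact_iff_function_exact _).1 (P.exact_succ n)

lemma aux_exact_zero {R : Type u} [CommRing R] {N : ModuleCat.{u} R}
    (P : ProjectiveResolution N) :
    ∃ ε : P.complex.X 0 →ₗ[R] N, Function.Exact (P.complex.d 1 0).hom ε ∧
      Function.Surjective ε :=
  ⟨(P.π.f 0).hom, (ShortComplex.ShortExact.moduleCat_exact_iff_function_exact _).1 P.exact₀,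
    (ModuleCat.epi_iff_surjective _).1 inferInstance⟩

lemma aux_proj {R : Type u} [CommRing R] {N : ModuleCat.{u} R}
    (P : ProjectiveResolution N) (n : ℕ) : Module.Projective R (P.complex.X n) :=
  (IsProjective.iff_projective _).2 (P.projective n)

/-- factoring through a projective kills Ext -/
lemma aux_ext_kill {R : Type u} [CommRing R] {M : ModuleCat.{u} R} (F : ModuleCat.{u} R)
    [Module.Projective R F] (f : M ⟶ F) (g : F ⟶ M) (r : R) (hfg : f ≫ g = r • 𝟙 M)
    (N : ModuleCat.{u} R) (i : ℕ) (hi : 1 ≤ i) :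
    r ∈ Module.annihilator R (((Ext R (ModuleCat.{u} R) i).obj (op M)).obj N) := by
  obtain ⟨n, rfl⟩ : ∃ n, i = n + 1 := ⟨i - 1, by omega⟩
  have P := projectiveResolution M
  have : Projective F := (IsProjective.iff_projective _).1 inferInstance
  let Q := ProjectiveResolution.self F
  let H : Homotopy (r • 𝟙 P.complex) (ProjectiveResolution.lift f P Q ≫ ProjectiveResolution.lift g Q P) :=
    ProjectiveResolution.liftHomotopy (f ≫ g) _ _ (by
      rw [hfg]
      ext
      simp
      rfl) (by simp)
  rw [aux_ext P]
  intro φ hφ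
  have hz : (ProjectiveResolution.lift f P Q ≫ ProjectiveResolution.lift g Q P).f (n+1) = 0 := by
    rw [HomologicalComplex.comp_f]
    have : (ProjectiveResolution.lift f P Q).f (n+1) = 0 :=
      (HomologicalComplex.isZero_single_obj_X (ComplexShape.down ℕ) 0 F (n + 1) (by simp)).eq_of_tgt _ _
    rw [this, Limits.zero_comp]
  have hc := H.comm (n+1)
  rw [hz, add_zero, dNext_eq H.hom (show (ComplexShape.down ℕ).Rel (n+1) n by simp),
    prevD_eq H.hom (show (ComplexShape.down ℕ).Rel (n+2) (n+1) by simp)] at hc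
  refine ⟨H.hom n (n+1) ≫ φ, ?_⟩
  have h2 := congrArg (· ≫ φ) hc
  simp only [HomologicalComplex.smul_f_apply, HomologicalComplex.id_f, Preadditive.add_comp, Category.assoc, hφ, Limits.comp_zero, add_zero] at h2
  rw [← h2]; simp

open TensorProduct in
lemma aux_tor_kill {R : Type u} [CommRing R] {M : ModuleCat.{u} R} (F : ModuleCat.{u} R)
    [Module.Projective R F] (f : M →ₗ[R] F) (g : F →ₗ[R] M) (r : R) (hfg : g ∘ₗ f = r • LinearMap.id)
    (N : ModuleCat.{u} R) (i : ℕ) (hi : 1 ≤ i) :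
    r ∈ Module.annihilator R (((Tor (ModuleCat.{u} R) i).obj M).obj N) := by
  obtain ⟨n, rfl⟩ : ∃ n, i = n + 1 := ⟨i - 1, by omega⟩
  have P := projectiveResolution N
  rw [aux_tor M P]
  intro x hx
  have hex := Module.Flat.lTensor_exact F (aux_exact_succ P n)
  have h1 : (P.complex.d (n+1) n).hom.lTensor F (f.rTensor _ x) = 0 := by
    rw [← LinearMap.comp_apply, LinearMap.lTensor_comp_rTensor, ← LinearMap.rTensor_comp_lTensor,
      LinearMap.comp_apply, hx, map_zero]
  obtain ⟨y, hy⟩ := (hex _).1 h1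
  refine ⟨g.rTensor _ y, ?_⟩
  rw [← LinearMap.comp_apply, LinearMap.lTensor_comp_rTensor, ← LinearMap.rTensor_comp_lTensor,
      LinearMap.comp_apply, hy, ← LinearMap.comp_apply, ← LinearMap.rTensor_comp, hfg]
  simp

/-- dimension shift for Ext -/
lemma aux_shift_ext {R : Type u} [CommRing R] {P3 P2 P1 P0 N K F1 F0 : Type u}
    [AddCommGroup P3] [AddCommGroup P2] [AddCommGroup P1] [AddCommGroup P0] [AddCommGroup N]
    [AddCommGroup K] [AddCommGroup F1] [AddCommGroup F0] [Module R P3]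
    [Module R P2] [Module R P1] [Module R P0] [Module R N]
    [Module R K] [Module R F1] [Module R F0]
    [Module.Projective R P2] [Module.Projective R P1] [Module.Projective R P0]
    [Module.Projective R F1] [Module.Projective R F0]
    (d3 : P3 →ₗ[R] P2) (d2 : P2 →ₗ[R] P1) (d1 : P1 →ₗ[R] P0) (ε : P0 →ₗ[R] N)
    (h32 : Function.Exact d3 d2) (h21 : Function.Exact d2 d1) (h10 : Function.Exact d1 ε)
    (hε : Function.Surjective ε)
    (ι : K →ₗ[R] F1) (q : F1 →ₗ[R] F0) (π : F0 →ₗ[R] N) (hι : Function.Injective ι)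
    (hq : Function.Exact ι q) (hqπ : Function.Exact q π) (hπ : Function.Surjective π) (r : R)
    (H : ∀ φ : P2 →ₗ[R] K, φ ∘ₗ d3 = 0 → ∃ ψ : P1 →ₗ[R] K, ψ ∘ₗ d2 = r • φ) :
    ∃ t : F1 →ₗ[R] F1, LinearMap.ker q ≤ LinearMap.ker t ∧ q ∘ₗ t = r • q := by
  have lift : ∀ {A B C X : Type u} [AddCommGroup A] [AddCommGroup B] [AddCommGroup C]
      [AddCommGroup X] [Module R A] [Module R B] [Module R C] [Module R X] [Module.Projective R X]
      (f : A →ₗ[R] B) (g : B →ₗ[R] C) (_ : Function.Exact f g) (x : X →ₗ[R] B) (_ : g ∘ₗ x = 0),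
      ∃ y : X →ₗ[R] A, f ∘ₗ y = x := by
    intro A B C X _ _ _ _ _ _ _ _ _ f g hfg x hx
    have hr : ∀ z, x z ∈ LinearMap.range f := fun z => (hfg (x z)).1 (LinearMap.congr_fun hx z)
    obtain ⟨y, hy⟩ := Module.projective_lifting_property f.rangeRestrict
      (x.codRestrict (LinearMap.range f) hr) f.surjective_rangeRestrict
    refine ⟨y, ?_⟩
    ext z
    exact congrArg Subtype.val (LinearMap.congr_fun hy z)
  obtain ⟨α0, hα0⟩ := Module.projective_lifting_property π ε hπ
  obtain ⟨β0, hβ0⟩ := Module.projective_lifting_property ε π hε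
  obtain ⟨α1, hα1⟩ := lift q π hqπ (α0 ∘ₗ d1) (by
    rw [← LinearMap.comp_assoc, hα0]; exact h10.linearMap_comp_eq_zero)
  obtain ⟨β1, hβ1⟩ := lift d1 ε h10 (β0 ∘ₗ q) (by
    rw [← LinearMap.comp_assoc, hβ0]; exact hqπ.linearMap_comp_eq_zero)
  obtain ⟨φ, hφ⟩ := lift ι q hq (α1 ∘ₗ d2) (by
    rw [← LinearMap.comp_assoc, hα1, LinearMap.comp_assoc, h21.linearMap_comp_eq_zero,
      LinearMap.comp_zero])
  obtain ⟨ψ, hψ⟩ := H φ (by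
    ext z
    apply hι
    have h1 := LinearMap.congr_fun hφ (d3 z)
    have h2 := LinearMap.congr_fun h32.linearMap_comp_eq_zero z
    simp only [LinearMap.comp_apply, LinearMap.zero_apply] at h1 h2 ⊢
    rw [h1, h2, map_zero, map_zero])
  obtain ⟨θ, hθ⟩ := lift q π hqπ (α0 ∘ₗ β0 - LinearMap.id) (by
    rw [LinearMap.comp_sub, ← LinearMap.comp_assoc, hα0, hβ0, LinearMap.comp_id, sub_self])
  refine ⟨(r • α1 - ι ∘ₗ ψ) ∘ₗ β1 - r • (θ ∘ₗ q), ?_, ?_⟩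
  · intro x hx
    have hx' : q x = 0 := hx
    have h1 := LinearMap.congr_fun hβ1 x
    simp only [LinearMap.comp_apply, hx', map_zero] at h1
    obtain ⟨w, hw⟩ := (h21 _).1 h1
    have h2 := LinearMap.congr_fun hψ w
    have h3 := LinearMap.congr_fun hφ w
    simp only [LinearMap.comp_apply, LinearMap.smul_apply] at h2 h3
    rw [LinearMap.mem_ker]
    simp only [LinearMap.sub_apply, LinearMap.comp_apply, LinearMap.smul_apply, hx', map_zero,
      smul_zero, sub_zero, ← hw, h2, map_smul, h3, sub_self]
  · ext x
    have h1 := LinearMap.congr_fun hβ1 x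
    have h2 := LinearMap.congr_fun hα1 (β1 x)
    have h3 := LinearMap.congr_fun hθ (q x)
    have h4 := hq.linearMap_comp_eq_zero
    have h4 := LinearMap.congr_fun h4 (ψ (β1 x))
    simp only [LinearMap.sub_apply, LinearMap.comp_apply, LinearMap.smul_apply, map_smul, map_sub,
      LinearMap.id_apply, LinearMap.zero_apply] at *
    rw [h2, h1, h3, h4, smul_sub]
    abel

open TensorProduct in
lemma aux_shift_tor {R : Type u} [CommRing R] {P2 P1 P0 N F0 T : Type u}
    [AddCommGroup P2] [AddCommGroup P1] [AddCommGroup P0] [AddCommGroup N]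
    [AddCommGroup F0] [AddCommGroup T]
    [Module R P2] [Module R P1] [Module R P0] [Module R N] [Module R F0] [Module R T]
    [Module.Projective R P0] [Module.Projective R F0]
    (d2 : P2 →ₗ[R] P1) (d1 : P1 →ₗ[R] P0) (ε : P0 →ₗ[R] N)
    (h21 : Function.Exact d2 d1) (h10 : Function.Exact d1 ε)
    (hε : Function.Surjective ε)
    (π : F0 →ₗ[R] N) (hπ : Function.Surjective π) (r : R)
    (H : ∀ x : T ⊗[R] P1, d1.lTensor T x = 0 → ∃ y : T ⊗[R] P2, d2.lTensor T y = r • x)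
    (ω : T ⊗[R] LinearMap.ker π) (hω : (LinearMap.ker π).subtype.lTensor T ω = 0) :
    r • ω = 0 := by
  obtain ⟨α0, hα0⟩ := Module.projective_lifting_property π ε hπ
  obtain ⟨β0, hβ0⟩ := Module.projective_lifting_property ε π hε
  let α : LinearMap.ker ε →ₗ[R] LinearMap.ker π := α0.restrict (fun x hx => by
    have := LinearMap.congr_fun hα0 x
    simp only [LinearMap.comp_apply] at this
    rw [LinearMap.mem_ker] at *
    rw [this, hx])
  let β : LinearMap.ker π →ₗ[R] LinearMap.ker ε := β0.restrict (fun x hx => by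
    have := LinearMap.congr_fun hβ0 x
    simp only [LinearMap.comp_apply] at this
    rw [LinearMap.mem_ker] at *
    rw [this, hx])
  let θ : F0 →ₗ[R] LinearMap.ker π := (α0 ∘ₗ β0 - LinearMap.id).codRestrict _ (fun x => by
    have h1 := LinearMap.congr_fun hα0 (β0 x)
    have h2 := LinearMap.congr_fun hβ0 x
    simp only [LinearMap.comp_apply] at h1 h2
    rw [LinearMap.mem_ker]
    simp [h1, h2])
  let δ : P1 →ₗ[R] LinearMap.ker ε := d1.codRestrict _ (fun x => (h10 _).2 ⟨x, rfl⟩)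
  have hδ : Function.Surjective δ := by
    rintro ⟨x, hx⟩
    obtain ⟨y, hy⟩ := (h10 x).1 hx
    exact ⟨y, Subtype.ext hy⟩
  obtain ⟨x, hx⟩ := LinearMap.lTensor_surjective T hδ (β.lTensor T ω)
  have hd1 : d1.lTensor T x = 0 := by
    have e1 : d1 = (LinearMap.ker ε).subtype ∘ₗ δ := rfl
    have e2 : (LinearMap.ker ε).subtype ∘ₗ β = β0 ∘ₗ (LinearMap.ker π).subtype := rfl
    rw [e1, LinearMap.lTensor_comp, LinearMap.comp_apply, hx, ← LinearMap.comp_apply,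
      ← LinearMap.lTensor_comp, e2, LinearMap.lTensor_comp, LinearMap.comp_apply, hω, map_zero]
  obtain ⟨y, hy⟩ := H x hd1
  have h0 : r • β.lTensor T ω = 0 := by
    have e3 : δ ∘ₗ d2 = 0 := by
      ext z
      exact LinearMap.congr_fun h21.linearMap_comp_eq_zero z
    rw [← hx, ← map_smul, ← hy, ← LinearMap.comp_apply, ← LinearMap.lTensor_comp, e3]
    simp
  have e4 : α ∘ₗ β = LinearMap.id + θ ∘ₗ (LinearMap.ker π).subtype := by
    ext z
    simp [α, β, θ]
  have h5 : (α ∘ₗ β).lTensor T ω = ω := by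
    rw [e4, LinearMap.lTensor_add, LinearMap.add_apply, LinearMap.lTensor_comp,
      LinearMap.comp_apply, hω]
    simp
  rw [← h5, LinearMap.lTensor_comp, LinearMap.comp_apply, ← map_smul, h0, map_zero]


section AuxLemmas

open TensorProduct

lemma aux_factor {R : Type u} [CommRing R] {A B C : Type u} [AddCommGroup A] [AddCommGroup B]
    [AddCommGroup C] [Module R A] [Module R B] [Module R C] (p : A →ₗ[R] B)
    (hp : Function.Surjective p) (g : A →ₗ[R] C) (h : LinearMap.ker p ≤ LinearMap.ker g) :
    ∃ f : B →ₗ[R] C, f ∘ₗ p = g := by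
  refine ⟨(LinearMap.ker p).liftQ g h ∘ₗ (p.quotKerEquivOfSurjective hp).symm.toLinearMap, ?_⟩
  ext x
  simp only [LinearMap.comp_apply, LinearEquiv.coe_coe]
  have : (p.quotKerEquivOfSurjective hp).symm (p x) = (LinearMap.ker p).mkQ x := by
    rw [LinearEquiv.symm_apply_eq]; rfl
  rw [this]; rfl

lemma aux_key {R : Type u} [CommRing R] {A B : Type u} [AddCommGroup A] [AddCommGroup B]
    [Module R A] [Module R B] (p : A →ₗ[R] B) (v : Module.Dual R B ⊗[R] B) :
    dualTensorHom R A B (p.dualMap.rTensor B v) = dualTensorHom R B B v ∘ₗ p := by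
  induction v with
  | zero => rw [map_zero, map_zero, map_zero, LinearMap.zero_comp]
  | tmul f y => rfl
  | add x y hx hy => rw [map_add, map_add, hx, hy, map_add, LinearMap.add_comp]

lemma aux_h0 {R : Type u} [CommRing R] {B : Type u} [AddCommGroup B]
    [Module R B] {m : ℕ} (p : (Fin m → R) →ₗ[R] B) :
    dualTensorHom R (Fin m → R) B (∑ i, (LinearMap.proj i) ⊗ₜ p (Pi.single i 1)) = p := by
  refine LinearMap.pi_ext' fun i => LinearMap.ext_ring ?_
  simp [LinearMap.sum_apply, Pi.single_apply]

lemma aux_ex {R : Type u} [CommRing R] {A B C J : Type u} [AddCommGroup A] [AddCommGroup B]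
    [AddCommGroup C] [AddCommGroup J] [Module R J]
    [Module R A] [Module R B] [Module R C] (f : A →ₗ[R] B) (g : B →ₗ[R] C) (h : Function.Exact f g)
    (hg : Function.Surjective g) (r : R) (ω : B ⊗[R] J) (hω : r • g.rTensor J ω = 0) :
    ∃ v : A ⊗[R] J, f.rTensor J v = r • ω := by
  rw [← map_smul] at hω
  exact (rTensor_exact J h hg _).1 hω

lemma aux_fin {R : Type u} [CommRing R] {A B : Type u} [AddCommGroup A] [AddCommGroup B]
    [Module R A] [Module R B] (p : A →ₗ[R] B) (hp : Function.Surjective p)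
    (v : Module.Dual R B ⊗[R] B) (r : R) (ω : Module.Dual R A ⊗[R] B)
    (hω : dualTensorHom R A B ω = p) (hv : p.dualMap.rTensor B v = r • ω) :
    dualTensorHom R B B v = r • LinearMap.id := by
  have h3 := aux_key p v
  rw [hv, map_smul, hω] at h3
  apply LinearMap.ext
  intro y
  obtain ⟨x, rfl⟩ := hp y
  exact (LinearMap.congr_fun h3 x).symm

lemma aux_hex {R : Type u} [CommRing R] {A B C : Type u} [AddCommGroup A] [AddCommGroup B]
    [AddCommGroup C] [Module R A] [Module R B] [Module R C] (f : A →ₗ[R] B) (p : B →ₗ[R] C)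
    (h : Function.Exact f p) (hp : Function.Surjective p) :
    Function.Exact p.dualMap f.dualMap.rangeRestrict := by
  intro g
  constructor
  · intro hg
    have hg' : g ∘ₗ f = 0 := congrArg Subtype.val hg
    obtain ⟨k, hk⟩ := aux_factor p hp g (fun x hx => by
      obtain ⟨y, rfl⟩ := (h x).1 hx
      exact LinearMap.congr_fun hg' y)
    exact ⟨k, hk⟩
  · rintro ⟨k, rfl⟩
    apply Subtype.ext
    apply LinearMap.ext
    intro x
    change k (p (f x)) = 0
    rw [(h (f x)).2 ⟨x, rfl⟩, map_zero]

lemma aux_hA0 {R : Type u} [CommRing R] {J : Type u} [AddCommGroup J] [Module R J]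
    {k m : ℕ} (A : (Fin k → R) →ₗ[R] (Fin m → R)) (p : (Fin m → R) →ₗ[R] J)
    (h : Function.Exact A p) :
    A.dualMap.rTensor J (∑ i, (LinearMap.proj i) ⊗ₜ p (Pi.single i 1)) = 0 := by
  have h1 : ∀ i, A.dualMap (LinearMap.proj i) =
      ∑ l, A (Pi.single l 1) i • (LinearMap.proj l : Module.Dual R (Fin k → R)) := by
    intro i
    ext x
    simp [Pi.single_apply]
  simp only [map_sum, LinearMap.rTensor_tmul, h1, sum_tmul, smul_tmul]
  rw [Finset.sum_comm]
  refine Finset.sum_eq_zero fun l _ => ?_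
  rw [← tmul_sum]
  have : ∑ i, A (Pi.single l 1) i • p (Pi.single i 1) = 0 := by
    simp only [← map_smul, ← map_sum]
    have h2 : ∑ i, A (Pi.single l 1) i • (Pi.single i 1 : Fin m → R) = A (Pi.single l 1) := by
      ext j; simp [Finset.sum_apply, Pi.single_apply]
    rw [h2]
    exact (h _).2 ⟨_, rfl⟩
  rw [this, tmul_zero]

lemma aux_hω {R : Type u} [CommRing R] {D E F0 : Type u} [AddCommGroup D] [AddCommGroup E]
    [AddCommGroup F0] [Module R D] [Module R E] [Module R F0] [Module.Flat R F0]
    (J : Submodule R F0) (f : D →ₗ[R] E) (ω : D ⊗[R] J) (h : f.rTensor J ω = 0) :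
    J.subtype.lTensor (LinearMap.range f) (f.rangeRestrict.rTensor J ω) = 0 := by
  apply Module.Flat.rTensor_preserves_injective_linearMap (M := F0) (LinearMap.range f).subtype
    (LinearMap.range f).injective_subtype
  rw [← LinearMap.comp_apply, LinearMap.rTensor_comp_lTensor, ← LinearMap.lTensor_comp_rTensor,
    LinearMap.comp_apply, ← LinearMap.comp_apply (LinearMap.rTensor _ _), ← LinearMap.rTensor_comp]
  have : (LinearMap.range f).subtype ∘ₗ f.rangeRestrict = f := rfl
  rw [this, h, map_zero, map_zero]

lemma aux_comb {R : Type u} [CommRing R] {C D E F0 : Type u} [AddCommGroup C] [AddCommGroup D]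
    [AddCommGroup E] [AddCommGroup F0] [Module R C] [Module R D] [Module R E] [Module R F0]
    [Module.Flat R F0] (J : Submodule R F0) (f0 : C →ₗ[R] D) (f : D →ₗ[R] E)
    (hex : Function.Exact f0 f.rangeRestrict) (r : R)
    (H : ∀ ω : LinearMap.range f ⊗[R] J, J.subtype.lTensor (LinearMap.range f) ω = 0 → r • ω = 0)
    (ω : D ⊗[R] J) (h : f.rTensor J ω = 0) :
    ∃ v : C ⊗[R] J, f0.rTensor J v = r • ω :=
  aux_ex f0 f.rangeRestrict hex f.surjective_rangeRestrict r ω (H _ (aux_hω J f ω h))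

/-- the Tor computation -/
lemma aux_tor_trace {R : Type u} [CommRing R] [IsNoetherianRing R] {F0 : Type u} [AddCommGroup F0]
    [Module R F0] [Module.Flat R F0] (J : Submodule R F0) [Module.Finite R J] (r : R)
    (H : ∀ (k : ℕ) (T : Submodule R (Module.Dual R (Fin k → R))) (ω : T ⊗[R] J),
      J.subtype.lTensor T ω = 0 → r • ω = 0) :
    ∃ u : Module.Dual R J ⊗[R] J, dualTensorHom R J J u = r • LinearMap.id := by
  obtain ⟨m, p, hp⟩ := Module.Finite.exists_fin' R J
  obtain ⟨k, A, hA⟩ : ∃ (k : ℕ) (A : (Fin k → R) →ₗ[R] (Fin m → R)), Function.Exact A p := by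
    obtain ⟨k, A', hA'⟩ := Module.Finite.exists_fin' R (LinearMap.ker p)
    refine ⟨k, (LinearMap.ker p).subtype ∘ₗ A', ?_⟩
    rw [LinearMap.exact_iff, LinearMap.range_comp, LinearMap.range_eq_top.2 hA']
    simp
  have h1 := aux_comb J p.dualMap A.dualMap (aux_hex A p hA hp) r (H k _)
    (∑ i, (LinearMap.proj i) ⊗ₜ p (Pi.single i 1)) (aux_hA0 A p hA)
  obtain ⟨v, hv⟩ := h1
  exact ⟨v, aux_fin p hp v r _ (aux_h0 p) hv⟩

def condI (R : Type u) [CommRing R] (S : Subalgebra R (Localization (nonZeroDivisors R))) : Ideal R :=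
  Submodule.comap (Algebra.linearMap R (Localization (nonZeroDivisors R)))
    ((1 : Submodule R (Localization (nonZeroDivisors R))) / (Subalgebra.toSubmodule S))

lemma mem_condI {R : Type u} [CommRing R] {S : Subalgebra R (Localization (nonZeroDivisors R))}
    {a : R} : a ∈ condI R S ↔ ∀ s ∈ S, ∃ b : R,
      algebraMap R (Localization (nonZeroDivisors R)) b = algebraMap R _ a * s := by
  simp [condI, Submodule.mem_div_iff_forall_mul_mem, Submodule.mem_one]

lemma alg_inj (R : Type u) [CommRing R] :
    Function.Injective (algebraMap R (Localization (nonZeroDivisors R))) :=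
  IsLocalization.injective _ le_rfl

lemma aux_trace {R : Type u} [CommRing R] (S : Subalgebra R (Localization (nonZeroDivisors R)))
    (x : R) (hx : x ∈ nonZeroDivisors R) (hxI : x ∈ condI R S)
    {J : Type u} [AddCommGroup J] [Module R J] (e : condI R S ≃ₗ[R] J) (r : R)
    (u : Module.Dual R J ⊗[R] J) (hu : dualTensorHom R J J u = r • LinearMap.id) :
    r ∈ condI R S := by
  have hsymm : ∀ (f : condI R S →ₗ[R] R) (a b : condI R S), f a * b = f b * a := by
    intro f a b
    have : (b : R) • a = (a : R) • b := Subtype.ext (mul_comm _ _)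
    have := congrArg f this
    simp only [map_smul, smul_eq_mul] at this
    rw [mul_comm, this, mul_comm]
  have key : ∀ u : Module.Dual R J ⊗[R] J, ∃ τ ∈ condI R S, ∀ a : condI R S,
      dualTensorHom R J J u (e a) = τ • e a := by
    intro u
    induction u with
    | zero => exact ⟨0, zero_mem _, by simp⟩
    | tmul f y =>
      obtain ⟨y, rfl⟩ := e.surjective y
      refine ⟨f (e y), ?_, ?_⟩
      · rw [mem_condI]
        intro s hs
        -- `s * y ∈ I`
        obtain ⟨b, hb⟩ := mem_condI.1 y.2 s hs
        have hbI : b ∈ condI R S := by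
          rw [mem_condI]
          intro s' hs'
          obtain ⟨b', hb'⟩ := mem_condI.1 y.2 (s * s') (mul_mem hs hs')
          exact ⟨b', by rw [hb', hb, mul_assoc]⟩
        refine ⟨f (e ⟨b, hbI⟩), ?_⟩
        have h1 := hsymm (f ∘ₗ e.toLinearMap) ⟨b, hbI⟩ ⟨x, hxI⟩
        have h2 := hsymm (f ∘ₗ e.toLinearMap) y ⟨x, hxI⟩
        simp only [LinearMap.comp_apply, LinearEquiv.coe_coe] at h1 h2
        have h1' := congrArg (algebraMap R (Localization (nonZeroDivisors R))) h1
        have h2' := congrArg (algebraMap R (Localization (nonZeroDivisors R))) h2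
        simp only [map_mul] at h1' h2'
        have hu : IsUnit (algebraMap R (Localization (nonZeroDivisors R)) x) :=
          IsLocalization.map_units _ (⟨x, hx⟩ : nonZeroDivisors R)
        apply hu.mul_right_cancel
        rw [h1', hb, mul_right_comm, h2', mul_assoc]
      · intro a
        have := hsymm (f ∘ₗ e.toLinearMap) a y
        simp only [LinearMap.comp_apply, LinearEquiv.coe_coe] at this
        rw [dualTensorHom_apply, ← map_smul, ← map_smul]
        congr 1
        exact Subtype.ext this
    | add u v hu hv =>
      obtain ⟨s, hs, hs'⟩ := hu
      obtain ⟨t, ht, ht'⟩ := hv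
      exact ⟨s + t, add_mem hs ht, fun a => by rw [map_add, LinearMap.add_apply, hs', ht', add_smul]⟩
  obtain ⟨τ, hτ, h⟩ := key u
  have := h ⟨x, hxI⟩
  rw [hu, LinearMap.smul_apply, LinearMap.id_apply, ← map_smul, ← map_smul] at this
  have := congrArg Subtype.val (e.injective this)
  have h5 : r * x = τ * x := this
  rw [mul_cancel_right_mem_nonZeroDivisors hx] at h5
  rwa [h5]

lemma aux_embed {R : Type u} [CommRing R] (S : Subalgebra R (Localization (nonZeroDivisors R)))
    (hS : (Subalgebra.toSubmodule S).FG) :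
    (∃ x ∈ nonZeroDivisors R, x ∈ condI R S) ∧
    ∃ (b : ℕ) (j : condI R S →ₗ[R] (Fin b → R)), Function.Injective j ∧
      Submodule.torsion R ((Fin b → R) ⧸ LinearMap.range j) = ⊥ := by
  obtain ⟨b, s, hs⟩ := Submodule.fg_iff_exists_fin_generating_family.1 hS
  have hsS : ∀ i, s i ∈ S := fun i => by
    have : s i ∈ Subalgebra.toSubmodule S := hs ▸ Submodule.subset_span ⟨i, rfl⟩
    exact this
  have hgen : ∀ a : Localization (nonZeroDivisors R), (∀ i, ∃ c : R, algebraMap R _ c = a * s i) →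
      ∀ t ∈ S, ∃ c : R, algebraMap R (Localization (nonZeroDivisors R)) c = a * t := by
    intro a ha t ht
    have ht' : t ∈ Submodule.span R (Set.range s) := by rw [hs]; exact ht
    induction ht' using Submodule.span_induction with
    | mem x hx => obtain ⟨i, rfl⟩ := hx; exact ha i
    | zero => exact ⟨0, by simp⟩
    | add x y hx hy h1 h2 =>
      obtain ⟨c, hc⟩ := h1 (by rw [hs] at hx; exact hx)
      obtain ⟨d, hd⟩ := h2 (by rw [hs] at hy; exact hy)
      exact ⟨c + d, by rw [map_add, hc, hd, mul_add]⟩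
    | smul r x hx h1 =>
      obtain ⟨c, hc⟩ := h1 (by rw [hs] at hx; exact hx)
      exact ⟨r * c, by rw [map_mul, hc, Algebra.smul_def]; ring⟩
  constructor
  · obtain ⟨x, hx⟩ := IsLocalization.exist_integer_multiples_of_finite (nonZeroDivisors R) s
    refine ⟨x, x.2, mem_condI.2 (hgen _ fun i => ?_)⟩
    obtain ⟨c, hc⟩ := hx i
    exact ⟨c, by rw [hc, Algebra.smul_def]⟩
  · choose φ hφ using fun (a : condI R S) (i : Fin b) => mem_condI.1 a.2 (s i) (hsS i)
    let j : condI R S →ₗ[R] (Fin b → R) :=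
      { toFun := φ
        map_add' := fun a a' => by
          ext i; apply alg_inj R; simp [hφ, add_mul]
        map_smul' := fun c a => by
          ext i; apply alg_inj R; simp [hφ, mul_assoc] }
    have hj : ∀ a i, algebraMap R (Localization (nonZeroDivisors R)) (j a i) = algebraMap R _ a * s i := hφ
    refine ⟨b, j, ?_, ?_⟩
    · rw [injective_iff_map_eq_zero]
      intro a ha
      have h0 : ∀ t ∈ Submodule.span R (Set.range s), algebraMap R _ (a : R) * t = 0 := by
        intro t ht
        induction ht using Submodule.span_induction with
        | mem x hx => obtain ⟨i, rfl⟩ := hx; rw [← hj, ha]; simp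
        | zero => simp
        | add x y hx hy h1 h2 => rw [mul_add, h1, h2, add_zero]
        | smul r x hx h1 => rw [mul_smul_comm, h1, smul_zero]
      have h1 := h0 1 (by rw [hs]; exact one_mem S)
      rw [mul_one, ← map_zero (algebraMap R (Localization (nonZeroDivisors R)))] at h1
      exact Subtype.ext (alg_inj R h1)
    · rw [eq_bot_iff]
      rintro z ⟨⟨d, hd⟩, hz⟩
      obtain ⟨v, rfl⟩ := Submodule.Quotient.mk_surjective _ z
      have hz' : d • (Submodule.Quotient.mk v : (Fin b → R) ⧸ LinearMap.range j) = 0 := hz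
      rw [← Submodule.Quotient.mk_smul, Submodule.Quotient.mk_eq_zero] at hz'
      obtain ⟨a, ha⟩ := hz'
      have hu : IsUnit (algebraMap R (Localization (nonZeroDivisors R)) d) :=
        IsLocalization.map_units _ (⟨d, hd⟩ : nonZeroDivisors R)
      obtain ⟨w, hw⟩ := hu.exists_left_inv
      have hv : ∀ i, algebraMap R (Localization (nonZeroDivisors R)) (v i) =
          (w * algebraMap R _ (a : R)) * s i := by
        intro i
        rw [mul_assoc, ← hj, ha, Pi.smul_apply, smul_eq_mul, map_mul, ← mul_assoc, hw, one_mul]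
      have hS' := hgen (w * algebraMap R _ (a : R)) (fun i => ⟨v i, hv i⟩)
      obtain ⟨c, hc⟩ := hS' 1 (one_mem S)
      rw [mul_one] at hc
      have hcI : c ∈ condI R S := mem_condI.2 (by rw [hc]; exact hS')
      rw [Submodule.mem_bot, Submodule.Quotient.mk_eq_zero]
      refine ⟨⟨c, hcI⟩, ?_⟩
      ext i
      apply alg_inj R
      rw [hj, hv, ← hc]

lemma aux_tf_sub {R : Type u} [CommRing R] {M : Type u} [AddCommGroup M] [Module R M]
    (h : Submodule.torsion R M = ⊥) (T : Submodule R M) : Submodule.torsion R T = ⊥ := by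
  rw [eq_bot_iff] at h ⊢
  rintro x ⟨a, ha⟩
  have : (x : M) ∈ Submodule.torsion R M := ⟨a, congrArg Subtype.val ha⟩
  exact Subtype.ext (h this)

lemma aux_conv_ext {R : Type u} [CommRing R] [IsNoetherianRing R]
    (𝒳 : Set (ModuleCat.{u} R))
    (h𝒳 : ∀ K : ModuleCat.{u} R,
      (∃ (P₁ P₀ N : ModuleCat.{u} R) (_ : Module.Finite R P₁) (_ : Module.Projective R P₁)
        (_ : Module.Finite R P₀) (_ : Module.Projective R P₀)
        (_ : Module.Finite R N) (_ : Submodule.torsion R N = ⊥)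
        (f : K →ₗ[R] P₁) (g : P₁ →ₗ[R] P₀) (h : P₀ →ₗ[R] N),
        Function.Injective f ∧ Function.Exact f g ∧ Function.Exact g h ∧
          Function.Surjective h) → K ∈ 𝒳) (r : R)
    (H : ∀ (M : ModuleCat.{u} R), Module.Finite R M → Submodule.torsion R M = ⊥ → ∀ N ∈ 𝒳,
      r ∈ Module.annihilator R (((Ext R (ModuleCat.{u} R) 2).obj (op M)).obj N))
    (S : Subalgebra R (Localization (nonZeroDivisors R))) (hS : (Subalgebra.toSubmodule S).FG) :
    r ∈ condI R S := by
  obtain ⟨⟨x, hx, hxI⟩, b, j, hj, htf⟩ := aux_embed S hS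
  obtain ⟨m, p, hp⟩ := Module.Finite.exists_fin' R (condI R S)
  let N := ModuleCat.of R ((Fin b → R) ⧸ LinearMap.range j)
  let q : (Fin m → R) →ₗ[R] (Fin b → R) := j ∘ₗ p
  let K := ModuleCat.of R (LinearMap.ker q)
  have hqr : LinearMap.range q = LinearMap.range j := by
    rw [LinearMap.range_comp, LinearMap.range_eq_top.2 hp, Submodule.map_top]
  have e1 : Function.Exact (LinearMap.ker q).subtype q := by
    rw [LinearMap.exact_iff]; simp
  have e2 : Function.Exact q (LinearMap.range j).mkQ := by
    rw [LinearMap.exact_iff, hqr]; simp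
  have hK : K ∈ 𝒳 := h𝒳 K ⟨ModuleCat.of R (Fin m → R), ModuleCat.of R (Fin b → R), N,
    inferInstanceAs (Module.Finite R (Fin m → R)), inferInstanceAs (Module.Projective R (Fin m → R)),
    inferInstanceAs (Module.Finite R (Fin b → R)), inferInstanceAs (Module.Projective R (Fin b → R)),
    inferInstanceAs (Module.Finite R ((Fin b → R) ⧸ LinearMap.range j)), htf,
    (LinearMap.ker q).subtype, q, (LinearMap.range j).mkQ,
    (LinearMap.ker q).injective_subtype, e1, e2, Submodule.mkQ_surjective _⟩
  have hN := H N (inferInstanceAs (Module.Finite R ((Fin b → R) ⧸ LinearMap.range j))) htf K hK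
  have P := projectiveResolution N
  rw [aux_ext P K 1 r] at hN
  obtain ⟨ε, hε, hε'⟩ := aux_exact_zero P
  have i2 := aux_proj P 2
  have i1 := aux_proj P 1
  have i0 := aux_proj P 0
  obtain ⟨t, ht, ht'⟩ := aux_shift_ext (K := LinearMap.ker q) (P.complex.d 3 2).hom
    (P.complex.d 2 1).hom (P.complex.d 1 0).hom ε (aux_exact_succ P 1) (aux_exact_succ P 0) hε hε'
    (LinearMap.ker q).subtype q (LinearMap.range j).mkQ (LinearMap.ker q).injective_subtype
    e1 e2 (Submodule.mkQ_surjective _) r (by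
      intro φ hφ
      obtain ⟨ψ, hψ⟩ := hN (ModuleCat.ofHom φ) (by
        apply ModuleCat.hom_ext
        exact hφ)
      exact ⟨ψ.hom, congrArg ModuleCat.Hom.hom hψ⟩)
  have hpt : p ∘ₗ t = r • p := by
    ext1 i
    apply LinearMap.ext_ring
    apply hj
    have := LinearMap.congr_fun ht' (Pi.single i 1)
    simpa [q] using this
  have hker : LinearMap.ker q = LinearMap.ker p :=
    LinearMap.ker_comp_of_ker_eq_bot _ (LinearMap.ker_eq_bot.2 hj)
  obtain ⟨t', hT⟩ := aux_factor p hp t (hker ▸ ht)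
  refine aux_trace S x hx hxI (LinearEquiv.refl R _) r
    (∑ i, (LinearMap.proj i ∘ₗ t') ⊗ₜ p (Pi.single i 1)) ?_
  apply LinearMap.ext
  intro y
  obtain ⟨z, rfl⟩ := hp y
  have h1 := LinearMap.congr_fun hpt z
  have h2 := LinearMap.congr_fun hT z
  simp only [LinearMap.comp_apply, LinearMap.smul_apply] at h1 h2
  simp only [map_sum, LinearMap.sum_apply, dualTensorHom_apply, LinearMap.comp_apply, h2,
    LinearMap.proj_apply, LinearMap.smul_apply, LinearMap.id_apply, ← h1]
  simp only [← map_smul, ← map_sum]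
  congr 1
  ext j; simp [Finset.sum_apply, Pi.single_apply]

lemma aux_conv_tor {R : Type u} [CommRing R] [IsNoetherianRing R] (r : R)
    (H : ∀ (M : ModuleCat.{u} R), Module.Finite R M → Submodule.torsion R M = ⊥ →
      ∀ (N : ModuleCat.{u} R), Module.Finite R N → Submodule.torsion R N = ⊥ →
      r ∈ Module.annihilator R (((Tor (ModuleCat.{u} R) 1).obj M).obj N))
    (S : Subalgebra R (Localization (nonZeroDivisors R))) (hS : (Subalgebra.toSubmodule S).FG) :
    r ∈ condI R S := by
  obtain ⟨⟨x, hx, hxI⟩, b, j, hj, htf⟩ := aux_embed S hS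
  let N := ModuleCat.of R ((Fin b → R) ⧸ LinearMap.range j)
  have P := projectiveResolution N
  obtain ⟨ε, hε, hε'⟩ := aux_exact_zero P
  have i0 := aux_proj P 0
  let π : (Fin b → R) →ₗ[R] N := (LinearMap.range j).mkQ
  obtain ⟨u, hu⟩ := aux_tor_trace (LinearMap.ker π) r (by
    intro k T ω hω
    have hT : Submodule.torsion R T = ⊥ := aux_tf_sub Module.Flat.torsion_eq_bot T
    have hN := H (ModuleCat.of R T) (inferInstanceAs (Module.Finite R T)) hT N
      (inferInstanceAs (Module.Finite R ((Fin b → R) ⧸ LinearMap.range j))) htf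
    rw [aux_tor _ P 0 r] at hN
    exact aux_shift_tor (P.complex.d 2 1).hom (P.complex.d 1 0).hom ε (aux_exact_succ P 0) hε hε'
      π (Submodule.mkQ_surjective _) r hN ω hω)
  have e : condI R S ≃ₗ[R] LinearMap.ker π :=
    (LinearEquiv.ofInjective j hj).trans (LinearEquiv.ofEq _ _ (Submodule.ker_mkQ _).symm)
  exact aux_trace S x hx hxI e r u hu

lemma aux_conv_final {R : Type u} [CommRing R] (r : R)
    (H : ∀ S : Subalgebra R (Localization (nonZeroDivisors R)),
      (Subalgebra.toSubmodule S).FG → r ∈ condI R S) :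
    r ∈ condI R (integralClosure R (Localization (nonZeroDivisors R))) := by
  rw [mem_condI]
  intro s hs
  exact mem_condI.1 (H (Algebra.adjoin R {s}) (IsIntegral.fg_adjoin_singleton hs)) s
    (Algebra.self_mem_adjoin_singleton R s)

lemma fwd_ded {R D : Type u} [CommRing R] [CommRing D] [IsNoetherianRing R]
    [Algebra R D] [IsDedekindDomain D] [Module.Finite R D] (δ : D →ₗ[R] R) (M : Type u) [AddCommGroup M]
    [Module R M] [Module.Finite R M]
    (hk : ∀ (w : D ⊗[R] M) (a : D), a ≠ 0 → a • w = 0 → TensorProduct.lid R M (δ.rTensor M w) = 0) :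
    ∃ (n : ℕ) (f : M →ₗ[R] (Fin n → R)) (g : (Fin n → R) →ₗ[R] M), g ∘ₗ f = δ 1 • LinearMap.id := by
  obtain ⟨n, π, hπ⟩ := Module.Finite.exists_fin' R M
  let T := Submodule.torsion D (D ⊗[R] M)
  let L := (D ⊗[R] M) ⧸ T
  have : Module.Flat D L := by
    rw [IsDedekindDomain.flat_iff_torsion_eq_bot]
    exact Submodule.QuotientTorsion.torsion_eq_bot
  have : Module.FinitePresentation D L := Module.finitePresentation_of_finite D L
  have : Module.Projective D L := Module.Flat.projective_of_finitePresentation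
  have hP : Function.Surjective (T.mkQ ∘ₗ π.baseChange D) := by
    rw [LinearMap.coe_comp]
    exact T.mkQ_surjective.comp (LinearMap.lTensor_surjective D hπ)
  obtain ⟨s, hs⟩ := Module.projective_lifting_property _ (LinearMap.id : L →ₗ[D] L) hP
  let ι : M →ₗ[R] D ⊗[R] M := TensorProduct.mk R D M 1
  refine ⟨n, (TensorProduct.lid R _).toLinearMap ∘ₗ δ.rTensor _ ∘ₗ (s ∘ₗ T.mkQ).restrictScalars R ∘ₗ ι, π, ?_⟩
  have hnat : ∀ w : D ⊗[R] (Fin n → R), π (TensorProduct.lid R _ (δ.rTensor _ w)) =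
      TensorProduct.lid R M (δ.rTensor M (π.baseChange D w)) := by
    intro w
    induction w with
    | zero => simp
    | tmul x y => simp
    | add x y hx hy => simp only [map_add, hx, hy]
  ext m
  simp only [LinearMap.comp_apply, LinearEquiv.coe_coe, LinearMap.restrictScalars_apply]
  rw [hnat]
  have h1 : T.mkQ (π.baseChange D (s (T.mkQ (ι m)))) = T.mkQ (ι m) := LinearMap.congr_fun hs _
  rw [← sub_eq_zero, ← map_sub, Submodule.mkQ_apply, Submodule.Quotient.mk_eq_zero] at h1
  obtain ⟨⟨a, ha⟩, h2⟩ := (Submodule.mem_torsion_iff _).1 h1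
  have h3 := hk _ a (nonZeroDivisors.ne_zero ha) h2
  rw [map_sub, map_sub, sub_eq_zero] at h3
  rw [h3]
  simp [ι]

lemma fwd_dedekind {R K : Type u} [CommRing R] [IsNoetherianRing R] (hdim : ringKrullDim R = 1) [Field K]
    [Algebra R K] [Module.Finite R (integralClosure R K)] 
    (hfr : ∀ k : K, ∃ r s : R, algebraMap R K s ≠ 0 ∧ k * algebraMap R K s = algebraMap R K r) :
    IsDedekindDomain (integralClosure R K) := by
  have : IsFractionRing (integralClosure R K) K := by
    refine (isLocalization_iff _ _).2 ⟨fun y => ?_, fun k => ?_, fun {x y} h => ⟨1, ?_⟩⟩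
    · have h0 : (y : integralClosure R K) ≠ 0 := nonZeroDivisors.ne_zero y.2
      exact IsUnit.mk0 _ (fun h => h0 (Subtype.ext h))
    · obtain ⟨r, s, hs, h⟩ := hfr k
      refine ⟨(algebraMap R _ r, ⟨algebraMap R _ s, mem_nonZeroDivisors_of_ne_zero ?_⟩), ?_⟩
      · intro h0
        exact hs (congrArg Subtype.val h0)
      · exact h
    · have : x = y := Subtype.ext h
      rw [this]
  have : IsNoetherianRing (integralClosure R K) := IsNoetherianRing.of_finite R _
  have : IsIntegrallyClosed (integralClosure R K) := by
    rw [isIntegrallyClosed_iff K]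
    intro x hx
    exact ⟨⟨x, isIntegral_trans x hx⟩, rfl⟩
  have : Ring.DimensionLEOne (integralClosure R K) := by
    constructor
    intro q hq hp
    have hR : Ring.KrullDimLE 1 R := by
      rw [Ring.krullDimLE_iff, hdim]; rfl
    rw [Ring.krullDimLE_one_iff] at hR
    obtain ⟨x, hx, hx0⟩ := Submodule.exists_mem_ne_zero_of_ne_bot hq
    have hlt : (⊥ : Ideal (integralClosure R K)).comap (algebraMap R _) < q.comap (algebraMap R _) :=
      Ideal.comap_lt_comap_of_integral_mem_sdiff bot_le ⟨hx, by simpa using hx0⟩ (Algebra.IsIntegral.isIntegral x)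
    rcases hR (q.comap (algebraMap R _)) inferInstance with h | h
    · exact absurd (h.2 ⟨inferInstance, bot_le⟩ hlt.le) (not_le_of_gt hlt)
    · exact Ideal.isMaximal_of_isIntegral_of_isMaximal_comap q h
  exact { maximalOfPrime := this.maximalOfPrime }

lemma fwd_kill {R D Q K : Type u} [CommRing R] [CommRing D] [CommRing Q] [Field K] [Algebra R Q]
    [IsFractionRing R Q] [Algebra R K] [Algebra R D] [IsDomain D]
    (φ : Q →ₐ[R] K) (σ : K →ₗ[R] Q) (h1 : ∀ k, φ (σ k) = k) (h2 : ∀ k l, σ (k * l) = σ k * σ l)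
    (h3 : ∀ q, q * σ 1 = σ (φ q))
    (j : D →ₐ[R] K) (hj : Function.Injective j) (hint : Algebra.IsIntegral R D)
    (δ : D →ₗ[R] R)
    (M : Type u) [AddCommGroup M] [Module R M] (hM : Submodule.torsion R M = ⊥)
    (w : D ⊗[R] M) (a : D) (ha : a ≠ 0) (haw : a • w = 0) :
    TensorProduct.lid R M (δ.rTensor M w) = 0 := by
  -- a nonzero multiple of a in R
  have hlt : (⊥ : Ideal D).comap (algebraMap R D) < (Ideal.span {a}).comap (algebraMap R _) :=
    Ideal.comap_lt_comap_of_integral_mem_sdiff bot_le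
      ⟨Ideal.mem_span_singleton_self a, by simpa using ha⟩ (Algebra.IsIntegral.isIntegral a)
  obtain ⟨b, hb, hb0⟩ := SetLike.exists_of_lt hlt
  have hb0' : algebraMap R K b ≠ 0 := by
    intro h
    apply hb0
    rw [Ideal.mem_comap, Ideal.mem_bot]
    apply hj
    rw [map_zero, AlgHom.commutes, h]
  obtain ⟨a', ha'⟩ := Ideal.mem_span_singleton'.1 (Ideal.mem_comap.1 hb)
  have hbw : b • w = 0 := by
    rw [← algebraMap_smul D b w, ← ha', mul_smul, haw, smul_zero]
  have hinj : Function.Injective (algebraMap R Q) := IsFractionRing.injective R Q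
  obtain ⟨⟨u, s⟩, hus⟩ := IsLocalization.surj (nonZeroDivisors R) (1 - σ 1 : Q)
  simp only at hus
  have hu0 : algebraMap R K u = 0 := by
    have := congrArg φ hus
    rw [map_mul, map_sub, h1, map_one, sub_self, zero_mul, AlgHom.commutes] at this
    exact this.symm
  have huδ : ∀ y, u * δ y = 0 := by
    intro y
    rw [← smul_eq_mul, ← map_smul]
    have : u • y = 0 := by
      apply hj
      rw [map_smul, Algebra.smul_def, hu0, zero_mul, map_zero]
    rw [this, map_zero]
  have huz : u • TensorProduct.lid R M (δ.rTensor M w) = 0 := by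
    clear haw hbw
    induction w with
    | zero => simp
    | tmul x y => simp [smul_smul, huδ]
    | add x y hx hy => simp only [map_add, smul_add, hx, hy, add_zero]
  have hbz : b • TensorProduct.lid R M (δ.rTensor M w) = 0 := by
    rw [← map_smul, ← map_smul, hbw, map_zero, map_zero]
  have he : σ 1 * σ 1 = σ 1 := by rw [← h2, one_mul]
  have hx : (s - u) * b + u ∈ nonZeroDivisors R := by
    have hun : IsUnit (algebraMap R Q ((s - u) * b + u)) := by
      have e1 : algebraMap R Q ((s - u) * b + u) =
          algebraMap R Q s * (algebraMap R Q b * σ 1 + (1 - σ 1)) := by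
        rw [map_add, map_mul, map_sub, ← hus]; ring
      rw [e1]
      refine (IsLocalization.map_units Q s).mul ?_
      refine IsUnit.of_mul_eq_one (σ (algebraMap R K b)⁻¹ + (1 - σ 1)) ?_
      have e2 : algebraMap R Q b * σ 1 = σ (algebraMap R K b) := by
        rw [h3, AlgHom.commutes]
      have e3 : σ (algebraMap R K b) * σ (algebraMap R K b)⁻¹ = σ 1 := by
        rw [← h2, mul_inv_cancel₀ hb0']
      have e4 : ∀ k, σ k * σ 1 = σ k := fun k => by rw [← h2, mul_one]
      rw [e2]
      have e5 := e4 (algebraMap R K b)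
      have e6 := e4 (algebraMap R K b)⁻¹
      linear_combination e3 - e5 - e6 + he
    rw [mem_nonZeroDivisors_iff_right]
    intro y hy
    apply hinj
    have := congrArg (algebraMap R Q) hy
    rw [map_mul, map_zero] at this
    rw [map_zero]
    exact (hun.mul_left_eq_zero).1 this
  have : TensorProduct.lid R M (δ.rTensor M w) ∈ Submodule.torsion R M := by
    rw [Submodule.mem_torsion_iff]
    refine ⟨⟨_, hx⟩, ?_⟩
    change ((s - u) * b + u) • _ = (0 : M)
    rw [add_smul, mul_smul, hbz, huz, smul_zero, add_zero]
  rwa [hM, Submodule.mem_bot] at this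

lemma fwd_comp {R Q K : Type u} [CommRing R] [IsNoetherianRing R] (hdim : ringKrullDim R = 1)
    [CommRing Q] [Field K] [Algebra R Q]
    [IsFractionRing R Q] [Algebra R K]
    (φ : Q →ₐ[R] K) (σ : K →ₗ[R] Q) (h1 : ∀ k, φ (σ k) = k) (h2 : ∀ k l, σ (k * l) = σ k * σ l)
    (h3 : ∀ q, q * σ 1 = σ (φ q)) (c : R)
    (hc : ∀ s ∈ integralClosure R Q, ∃ b : R, algebraMap R Q b = algebraMap R Q c * s) :
    ∃ d : R, algebraMap R Q d = algebraMap R Q c * σ 1 ∧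
      ∀ (M : Type u) [AddCommGroup M] [Module R M] [Module.Finite R M], Submodule.torsion R M = ⊥ →
      ∃ (n : ℕ) (f : M →ₗ[R] (Fin n → R)) (g : (Fin n → R) →ₗ[R] M),
        g ∘ₗ f = d • LinearMap.id := by
  have hinj : Function.Injective (algebraMap R Q) := IsFractionRing.injective R Q
  by_cases hc0 : algebraMap R K c = 0
  · refine ⟨0, ?_, ?_⟩
    · rw [h3, AlgHom.commutes, hc0, map_zero, map_zero]
    · intro M _ _ _ _
      exact ⟨0, 0, 0, by simp⟩
  have hσ : ∀ y ∈ integralClosure R K, σ y ∈ integralClosure R Q := by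
    rintro y ⟨p, hp, hpy⟩
    refine ⟨Polynomial.X * p, Polynomial.monic_X.mul hp, ?_⟩
    have key : ∀ p : Polynomial R, σ y * Polynomial.eval₂ (algebraMap R Q) (σ y) p =
        σ (y * Polynomial.eval₂ (algebraMap R K) y p) := by
      intro p
      have e4 : σ y * σ 1 = σ y := by rw [← h2, mul_one]
      have := h3 (Polynomial.eval₂ (algebraMap R Q) (σ y) p)
      have e : φ (Polynomial.eval₂ (algebraMap R Q) (σ y) p) = Polynomial.eval₂ (algebraMap R K) y p := by
        have := Polynomial.aeval_algHom_apply φ (σ y) p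
        rw [h1] at this
        exact this.symm
      rw [h2, ← e, ← this, mul_comm _ (σ 1), ← mul_assoc, e4]
    rw [Polynomial.eval₂_mul, Polynomial.eval₂_X, key, hpy, mul_zero, map_zero]
  have hex : ∀ y : integralClosure R K, ∃ b : R, algebraMap R Q b = algebraMap R Q c * σ y :=
    fun y => hc _ (hσ y y.2)
  choose δ0 hδ0 using hex
  let δ : integralClosure R K →ₗ[R] R :=
    { toFun := δ0
      map_add' := fun x y => hinj (by simp only [hδ0, map_add, Subalgebra.coe_add, mul_add])
      map_smul' := fun r x => hinj (by
        simp only [hδ0, smul_eq_mul, map_mul, RingHom.id_apply]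
        rw [show ((r • x : integralClosure R K) : K) = r • (x : K) from rfl, map_smul,
          Algebra.smul_def]
        ring) }
  have hδ : ∀ y, algebraMap R Q (δ y) = algebraMap R Q c * σ y := hδ0
  have hδi : Function.Injective δ := by
    rw [injective_iff_map_eq_zero]
    intro y hy
    have := hδ y
    rw [hy, map_zero] at this
    have := congrArg φ this
    rw [map_zero, map_mul, h1, AlgHom.commutes] at this
    exact Subtype.ext ((mul_eq_zero.1 this.symm).resolve_left hc0)
  have : Module.Finite R (integralClosure R K) := Module.Finite.of_injective δ hδi
  have : IsDedekindDomain (integralClosure R K) := by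
    refine fwd_dedekind hdim (fun k => ?_)
    obtain ⟨⟨r, s⟩, hrs⟩ := IsLocalization.surj (nonZeroDivisors R) (σ k)
    refine ⟨r, s, ?_, ?_⟩
    · have := (IsLocalization.map_units Q s).map φ
      rw [AlgHom.commutes] at this
      exact this.ne_zero
    · have := congrArg φ hrs
      rwa [map_mul, h1, AlgHom.commutes, AlgHom.commutes] at this
  refine ⟨δ 1, hδ 1, ?_⟩
  intro M _ _ _ hM
  refine fwd_ded δ M (fun w a ha haw => ?_)
  exact fwd_kill φ σ h1 h2 h3 (integralClosure R K).val Subtype.val_injective inferInstance δ M hM w a ha haw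

lemma fwd_artin {R Q : Type u} [CommRing R] [IsNoetherianRing R] [IsReduced R] [CommRing Q] [Algebra R Q]
    [IsFractionRing R Q] : IsReduced Q ∧ IsArtinianRing Q := by
  have hr : IsReduced Q := isReduced_localizationPreserves (nonZeroDivisors R) Q inferInstance
  have hn : IsNoetherianRing Q := IsLocalization.isNoetherianRing (nonZeroDivisors R) Q inferInstance
  refine ⟨hr, isArtinianRing_iff_isNoetherianRing_krullDimLE_zero.2 ⟨hn, Ring.KrullDimLE.mk₀ fun p hp => ?_⟩⟩
  obtain ⟨m, hm, hpm⟩ := Ideal.exists_le_maximal p hp.ne_top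
  have hQ : IsFractionRing Q Q := IsFractionRing.idem R Q
  obtain ⟨_, a, ha⟩ := hm.mem_associatedPrimes_of_isFractionRing
  have hmem : ∀ x, x ∈ m ↔ ∃ n : ℕ, x ^ n * a = 0 := by
    intro x
    rw [ha]
    simp [Ideal.mem_radical_iff, Submodule.mem_colon_singleton]
  have ham : a ∉ m := by
    intro h
    obtain ⟨n, hn⟩ := (hmem a).1 h
    have h0 : a = 0 := eq_zero_of_pow_eq_zero (n := n + 1) (by rw [pow_succ, hn])
    exact hm.ne_top ((Ideal.eq_top_iff_one _).2 ((hmem 1).2 ⟨0, by simp [h0]⟩))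
  have hmp : m ≤ p := by
    intro x hx
    obtain ⟨n, hn⟩ := (hmem x).1 hx
    have h0 : x ^ n * a ∈ p := by rw [hn]; exact p.zero_mem
    exact hp.mem_of_pow_mem n ((hp.mem_or_mem h0).resolve_right (fun h => ham (hpm h)))
  rwa [le_antisymm hpm hmp]

lemma fwd_all {R Q : Type u} [CommRing R] [IsNoetherianRing R] (hdim : ringKrullDim R = 1) [IsReduced R]
    [CommRing Q] [Algebra R Q] [IsFractionRing R Q] (c : R)
    (hc : ∀ s ∈ integralClosure R Q, ∃ b : R, algebraMap R Q b = algebraMap R Q c * s) :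
    ∃ (ι : Type u) (_ : Fintype ι) (d : ι → R), c = ∑ i, d i ∧
      ∀ (i : ι) (M : Type u) [AddCommGroup M] [Module R M] [Module.Finite R M], Submodule.torsion R M = ⊥ →
      ∃ (n : ℕ) (f : M →ₗ[R] (Fin n → R)) (g : (Fin n → R) →ₗ[R] M),
        g ∘ₗ f = d i • LinearMap.id := by
  classical
  obtain ⟨hr, ha⟩ := fwd_artin (R := R) (Q := Q)
  let E := IsArtinianRing.equivPi Q
  have key : ∀ P : MaximalSpectrum Q, ∃ d : R, algebraMap R Q d = algebraMap R Q c * E.symm (Pi.single P 1) ∧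
      ∀ (M : Type u) [AddCommGroup M] [Module R M] [Module.Finite R M], Submodule.torsion R M = ⊥ →
      ∃ (n : ℕ) (f : M →ₗ[R] (Fin n → R)) (g : (Fin n → R) →ₗ[R] M),
        g ∘ₗ f = d • LinearMap.id := by
    intro P
    let _ : Field (Q ⧸ P.asIdeal) := Ideal.Quotient.field _
    let σ : (Q ⧸ P.asIdeal) →ₗ[R] Q :=
      (E.symm.toLinearMap.restrictScalars R) ∘ₗ
        ((LinearMap.single Q (fun I : MaximalSpectrum Q => Q ⧸ I.asIdeal) P).restrictScalars R)
    have hσ : ∀ k, σ k = E.symm (Pi.single P k) := fun k => rfl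
    refine fwd_comp hdim (Ideal.Quotient.mkₐ R P.asIdeal) σ ?_ ?_ ?_ c hc
    · intro k
      have : E (σ k) P = k := by rw [hσ, E.apply_symm_apply, Pi.single_eq_same]
      exact this
    · intro k l
      rw [hσ, hσ, hσ, ← map_mul, ← Pi.single_mul]
    · intro q
      apply E.injective
      rw [map_mul, hσ, hσ, E.apply_symm_apply, E.apply_symm_apply, ← Pi.single_mul_right, mul_one]
      rfl
  choose d hd hM using key
  refine ⟨MaximalSpectrum Q, Fintype.ofFinite _, d, ?_, hM⟩
  apply IsFractionRing.injective R Q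
  rw [map_sum]
  simp only [hd]
  rw [← Finset.mul_sum, ← map_sum]
  let _ := Fintype.ofFinite (MaximalSpectrum Q)
  have h1 := Finset.univ_sum_single (1 : ∀ I : MaximalSpectrum Q, Q ⧸ I.asIdeal)
  simp only [Pi.one_apply] at h1
  rw [h1, map_one, mul_one]

lemma fwd_red {R : Type u} [CommRing R] [IsNoetherianRing R] [IsLocalRing R]
    (hred : IsReduced (AdicCompletion (IsLocalRing.maximalIdeal R) R)) : IsReduced R := by
  refine isReduced_of_injective (algebraMap R (AdicCompletion (IsLocalRing.maximalIdeal R) R)) ?_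
  exact AdicCompletion.of_injective (IsLocalRing.maximalIdeal R) R

end AuxLemmas

/-- Let `(R, 𝔪)` be a one-dimensional Noetherian local ring whose `𝔪`-adic completion is
reduced.  Let `𝒳` be a class of `R`-modules containing every second syzygy of a finitely
generated torsion-free `R`-module, and `𝒴` a class of `R`-modules containing all finitely
generated torsion-free `R`-modules.  Then
`⋂_{i≥1, M fg tf, N ∈ 𝒳} ann Ext^i(M,N) = ⋂_{i≥2, M fg tf, N ∈ 𝒳} ann Ext^i(M,N)
  = ⋂_{i≥1, M fg tf, N ∈ 𝒴} ann Tor_i(M,N) = 𝒞(R)`. -/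
theorem ann_ext_tor_classes_eq_conductor (R : Type u) [CommRing R] [IsNoetherianRing R]
    [IsLocalRing R] (hdim : ringKrullDim R = 1)
    (hred : IsReduced (AdicCompletion (IsLocalRing.maximalIdeal R) R))
    (𝒳 𝒴 : Set (ModuleCat.{u} R))
    (h𝒳 : ∀ K : ModuleCat.{u} R,
      (∃ (P₁ P₀ N : ModuleCat.{u} R) (_ : Module.Finite R P₁) (_ : Module.Projective R P₁)
        (_ : Module.Finite R P₀) (_ : Module.Projective R P₀)
        (_ : Module.Finite R N) (_ : Submodule.torsion R N = ⊥)
        (f : K →ₗ[R] P₁) (g : P₁ →ₗ[R] P₀) (h : P₀ →ₗ[R] N),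
        Function.Injective f ∧ Function.Exact f g ∧ Function.Exact g h ∧
          Function.Surjective h) → K ∈ 𝒳)
    (h𝒴 : ∀ N : ModuleCat.{u} R,
      Module.Finite R N → Submodule.torsion R N = ⊥ → N ∈ 𝒴) :
    (⨅ (i : ℕ) (_ : 1 ≤ i)
        (M : ModuleCat.{u} R) (_ : Module.Finite R M) (_ : Submodule.torsion R M = ⊥)
        (N : ModuleCat.{u} R) (_ : N ∈ 𝒳),
        Module.annihilator R (((Ext R (ModuleCat.{u} R) i).obj (op M)).obj N)) =
      conductorIdeal R ∧
    (⨅ (i : ℕ) (_ : 2 ≤ i)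
        (M : ModuleCat.{u} R) (_ : Module.Finite R M) (_ : Submodule.torsion R M = ⊥)
        (N : ModuleCat.{u} R) (_ : N ∈ 𝒳),
        Module.annihilator R (((Ext R (ModuleCat.{u} R) i).obj (op M)).obj N)) =
      conductorIdeal R ∧
    (⨅ (i : ℕ) (_ : 1 ≤ i)
        (M : ModuleCat.{u} R) (_ : Module.Finite R M) (_ : Submodule.torsion R M = ⊥)
        (N : ModuleCat.{u} R) (_ : N ∈ 𝒴),
        Module.annihilator R (((Tor (ModuleCat.{u} R) i).obj M).obj N)) =
      conductorIdeal R := by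
  have hR : IsReduced R := fwd_red hred
  have hfac : ∀ c ∈ conductorIdeal R, ∃ (ι : Type u) (_ : Fintype ι) (d : ι → R), c = ∑ i, d i ∧
      ∀ (i : ι) (M : Type u) [AddCommGroup M] [Module R M] [Module.Finite R M],
      Submodule.torsion R M = ⊥ →
      ∃ (n : ℕ) (f : M →ₗ[R] (Fin n → R)) (g : (Fin n → R) →ₗ[R] M),
        g ∘ₗ f = d i • LinearMap.id := fun c hc =>
    fwd_all (Q := Localization (nonZeroDivisors R)) hdim c
      (mem_condI.1 (show c ∈ condI R (integralClosure R _) from hc))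
  have hE : ∀ c ∈ conductorIdeal R, ∀ (i : ℕ), 1 ≤ i → ∀ (M : ModuleCat.{u} R),
      Module.Finite R M → Submodule.torsion R M = ⊥ → ∀ N : ModuleCat.{u} R,
      c ∈ Module.annihilator R (((Ext R (ModuleCat.{u} R) i).obj (op M)).obj N) := by
    intro c hc i hi M hM1 hM2 N
    obtain ⟨ι, _, d, hcd, hd⟩ := hfac c hc
    rw [hcd]
    refine Ideal.sum_mem _ (fun j _ => ?_)
    obtain ⟨n, f, g, hfg⟩ := hd j M hM2
    exact aux_ext_kill (ModuleCat.of R (Fin n → R)) (ModuleCat.ofHom f) (ModuleCat.ofHom g) (d j)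
      (by ext x; exact LinearMap.congr_fun hfg x) N i hi
  have hT : ∀ c ∈ conductorIdeal R, ∀ (i : ℕ), 1 ≤ i → ∀ (M : ModuleCat.{u} R),
      Module.Finite R M → Submodule.torsion R M = ⊥ → ∀ N : ModuleCat.{u} R,
      c ∈ Module.annihilator R (((Tor (ModuleCat.{u} R) i).obj M).obj N) := by
    intro c hc i hi M hM1 hM2 N
    obtain ⟨ι, _, d, hcd, hd⟩ := hfac c hc
    rw [hcd]
    refine Ideal.sum_mem _ (fun j _ => ?_)
    obtain ⟨n, f, g, hfg⟩ := hd j M hM2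
    exact aux_tor_kill (ModuleCat.of R (Fin n → R)) f g (d j) hfg N i hi
  have hC : ∀ r : R, (∀ M : ModuleCat.{u} R, Module.Finite R M → Submodule.torsion R M = ⊥ →
      ∀ N ∈ 𝒳, r ∈ Module.annihilator R (((Ext R (ModuleCat.{u} R) 2).obj (op M)).obj N)) →
      r ∈ conductorIdeal R := fun r H =>
    aux_conv_final r (fun S hS => aux_conv_ext 𝒳 h𝒳 r H S hS)
  refine ⟨le_antisymm ?_ ?_, le_antisymm ?_ ?_, le_antisymm ?_ ?_⟩
  · intro r hr
    simp only [Submodule.mem_iInf] at hr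
    exact hC r (fun M h1 h2 N hN => hr 2 one_le_two M h1 h2 N hN)
  · intro r hr
    simp only [Submodule.mem_iInf]
    exact fun i hi M h1 h2 N _ => hE r hr i hi M h1 h2 N
  · intro r hr
    simp only [Submodule.mem_iInf] at hr
    exact hC r (fun M h1 h2 N hN => hr 2 le_rfl M h1 h2 N hN)
  · intro r hr
    simp only [Submodule.mem_iInf]
    exact fun i hi M h1 h2 N _ => hE r hr i (one_le_two.trans hi) M h1 h2 N
  · intro r hr
    simp only [Submodule.mem_iInf] at hr
    exact aux_conv_final r (fun S hS => aux_conv_tor r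
      (fun M h1 h2 N h3 h4 => hr 1 le_rfl M h1 h2 N (h𝒴 N h3 h4)) S hS)
  · intro r hr
    simp only [Submodule.mem_iInf]
    exact fun i hi M h1 h2 N _ => hT r hr i hi M h1 h2 N
end
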